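/- arXiv:1209.4799 — 3 statements merged into one kernel-verified Lean document; each statement's English description precedes it below -/
import Mathlib

section
/- For every n ≥ 1, the number of (n,2) left Gog trapezoids equals the number of (n,2) left GOGAm trapezoids. -/
/-- A Gelfand-Tsetlin triangle of size `n`: a triangular array `X i j` for
`n ≥ i ≥ j ≥ 1` of positive integers with `X (i+1) j ≤ X i j ≤ X (i+1) (j+1)`. -/
def IsGT (n : ℕ) (X : ℕ → ℕ → ℕ) : Prop :=
  (∀ i j, 1 ≤ j → j ≤ i → i ≤ n → 1 ≤ X i j) ∧
  (∀ i j, 1 ≤ j → j ≤ i → i + 1 ≤ n → X (i + 1) j ≤ X i j ∧ X i j ≤ X (i + 1) (j + 1))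

/-- A Gog triangle of size `n`: a Gelfand-Tsetlin triangle with strictly increasing
rows and top row `X n j = j`. -/
def IsGog (n : ℕ) (X : ℕ → ℕ → ℕ) : Prop :=
  IsGT n X ∧
  (∀ i j, 1 ≤ j → j + 1 ≤ i → i ≤ n → X i j < X i (j + 1)) ∧
  (∀ j, 1 ≤ j → j ≤ n → X n j = j)

/-- A GOGAm triangle of size `n`: a Gelfand-Tsetlin triangle with `X n n ≤ n` and,
for all `1 ≤ k ≤ n - 1` and all strictly decreasing sequences
`n = j 0 > j 1 > ⋯ > j (n - k) ≥ 1`,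
`(∑ i in range (n-k), (X (j i + i) (j i) - X (j (i+1) + i) (j (i+1))))
  + X (j (n-k) + (n-k)) (j (n-k)) ≤ k`. -/
def IsGOGAm (n : ℕ) (X : ℕ → ℕ → ℕ) : Prop :=
  IsGT n X ∧ X n n ≤ n ∧
  ∀ k : ℕ, 1 ≤ k → k ≤ n - 1 →
    ∀ j : ℕ → ℕ, j 0 = n → (∀ i, i < n - k → j (i + 1) < j i) → 1 ≤ j (n - k) →
      (∑ i ∈ Finset.range (n - k),
          ((X (j i + i) (j i) : ℤ) - (X (j (i + 1) + i) (j (i + 1)) : ℤ)))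
        + (X (j (n - k) + (n - k)) (j (n - k)) : ℤ) ≤ (k : ℤ)

/-- The set of `(n,k)` right Gog trapezoids, encoded as functions that agree with
some Gog triangle of size `n` on the `k` rightmost SW-NE diagonals
(`1 ≤ j ≤ i ≤ n`, `i - j ≤ k - 1`, i.e. `i < j + k`) and vanish elsewhere. -/
def RightGogTrapSet (n k : ℕ) : Set (ℕ → ℕ → ℕ) :=
  { X | ∃ Z, IsGog n Z ∧
      ∀ i j, X i j = if 1 ≤ j ∧ j ≤ i ∧ i ≤ n ∧ i < j + k then Z i j else 0 }

/-- The set of `(n,k)` left Gog trapezoids, encoded as functions that agree with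
some Gog triangle of size `n` on the `k` leftmost NW-SE diagonals
(`1 ≤ j ≤ i ≤ n`, `j ≤ k`) and vanish elsewhere. -/
def LeftGogTrapSet (n k : ℕ) : Set (ℕ → ℕ → ℕ) :=
  { X | ∃ Z, IsGog n Z ∧
      ∀ i j, X i j = if 1 ≤ j ∧ j ≤ i ∧ i ≤ n ∧ j ≤ k then Z i j else 0 }

/-- The set of `(n,k)` right GOGAm trapezoids, encoded as functions that agree with
some GOGAm triangle of size `n` on the `k` rightmost SW-NE diagonals and vanish
elsewhere. -/
def RightGOGAmTrapSet (n k : ℕ) : Set (ℕ → ℕ → ℕ) :=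
  { X | ∃ Z, IsGOGAm n Z ∧
      ∀ i j, X i j = if 1 ≤ j ∧ j ≤ i ∧ i ≤ n ∧ i < j + k then Z i j else 0 }

/-- The set of `(n,k)` left GOGAm trapezoids, encoded as functions that agree with
some GOGAm triangle of size `n` on the `k` leftmost NW-SE diagonals and vanish
elsewhere. -/
def LeftGOGAmTrapSet (n k : ℕ) : Set (ℕ → ℕ → ℕ) :=
  { X | ∃ Z, IsGOGAm n Z ∧
      ∀ i j, X i j = if 1 ≤ j ∧ j ≤ i ∧ i ≤ n ∧ j ≤ k then Z i j else 0 }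

/-- The indicator of a tie between rows `i` and `i + 1` of a column. -/
def tie (a : ℕ → ℕ) (i : ℕ) : ℕ := if a i = a (i + 1) then 1 else 0

/-- The array whose first two columns are given and whose other entries vanish. -/
def arrayOfColumns (p : (ℕ → ℕ) × (ℕ → ℕ)) (i j : ℕ) : ℕ :=
  if j = 1 then p.1 i else if j = 2 then p.2 i else 0

/-- Pairs of columns with an admissible first column, together with the support condition on the second column. -/
def IsColumnPair (n : ℕ) (p : (ℕ → ℕ) × (ℕ → ℕ)) : Prop :=
  (∀ i, i < 1 ∨ n < i → p.1 i = 0) ∧ (∀ i, i < 2 ∨ n < i → p.2 i = 0) ∧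
  (∀ i, 1 ≤ i → i ≤ n → 1 ≤ p.1 i) ∧ (∀ i, 1 ≤ i → i + 1 ≤ n → p.1 (i + 1) ≤ p.1 i) ∧
  p.1 n = 1

/-- Column pairs interpolating between left Gog trapezoids (`k = 1`) and left GOGAm trapezoids
(`k = n`, after adding to each entry of the second column the tie of the first column above it):
the first `k - 1` monotonicity conditions on the second column are of GOGAm type, the others of
Gog type. -/
def mixedColumns (n k : ℕ) : Set ((ℕ → ℕ) × (ℕ → ℕ)) :=
  { p | IsColumnPair n p ∧
    (∀ i, 1 ≤ i → i + 1 ≤ n → p.1 i + tie p.1 i ≤ p.2 (i + 1) ∧ p.2 (i + 1) + i ≤ n + 1) ∧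
    (∀ i, 1 ≤ i → i + 2 ≤ n → i < k →
      p.2 (i + 2) + tie p.1 i ≤ p.2 (i + 1) + tie p.1 (i + 1)) ∧
    (∀ i, 1 ≤ i → i + 2 ≤ n → k ≤ i → p.2 (i + 2) ≤ p.2 (i + 1)) }

/-- The column pairs of left GOGAm trapezoids. -/
def gogamColumns (n : ℕ) : Set ((ℕ → ℕ) × (ℕ → ℕ)) :=
  { p | IsColumnPair n p ∧
    (∀ i, 1 ≤ i → i + 1 ≤ n → p.1 i ≤ p.2 (i + 1) ∧ p.2 (i + 1) + tie p.1 i + i ≤ n + 1) ∧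
    (∀ i, 1 ≤ i → i + 2 ≤ n → p.2 (i + 2) ≤ p.2 (i + 1)) }

theorem arrayOfColumns_injective : Function.Injective arrayOfColumns := by
  intro p q h
  refine Prod.ext (funext fun i => ?_) (funext fun i => ?_)
  · simpa [arrayOfColumns] using congrFun (congrFun h i) 1
  · simpa [arrayOfColumns] using congrFun (congrFun h i) 2

/-- Forward move turning the Gog condition between rows `k + 1` and `k + 2` into a GOGAm one. -/
def toGOGAmStep (k : ℕ) (p : (ℕ → ℕ) × (ℕ → ℕ)) : (ℕ → ℕ) × (ℕ → ℕ) :=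
  if p.1 k = p.1 (k + 1) ∧ p.1 (k + 1) ≠ p.1 (k + 2) ∧ p.2 (k + 1) = p.2 (k + 2) then
    (Function.update p.1 (k + 1) (p.1 (k + 2)), Function.update p.2 (k + 1) (p.2 (k + 1) - 1))
  else p

/-- Inverse of `toGOGAmStep`. -/
def toGogStep (k : ℕ) (p : (ℕ → ℕ) × (ℕ → ℕ)) : (ℕ → ℕ) × (ℕ → ℕ) :=
  if p.1 k ≠ p.1 (k + 1) ∧ p.1 (k + 1) = p.1 (k + 2) ∧ p.2 (k + 1) + 1 = p.2 (k + 2) then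
    (Function.update p.1 (k + 1) (p.1 k), Function.update p.2 (k + 1) (p.2 (k + 1) + 1))
  else p

theorem toGOGAmStep_mem {n k : ℕ} (hk : 1 ≤ k) (hkn : k + 2 ≤ n) {p : (ℕ → ℕ) × (ℕ → ℕ)}
    (hp : p ∈ mixedColumns n k) : toGOGAmStep k p ∈ mixedColumns n (k + 1) := by
  obtain ⟨a, b⟩ := p
  obtain ⟨⟨h1, h2, h3, h4, h5⟩, h6, h7, h8⟩ := hp
  simp only at h1 h2 h3 h4 h5 h6 h7 h8
  unfold toGOGAmStep
  have e1 := h6 k hk (by omega)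
  have e2 := h6 (k + 1) (by omega) (by omega)
  have e3 := h8 k hk hkn le_rfl
  have e4 := h4 k hk (by omega)
  have e5 := h4 (k + 1) (by omega) (by omega)
  split_ifs with hc
  · simp only at hc
    refine ⟨⟨?_, ?_, ?_, ?_, ?_⟩, ?_, ?_, ?_⟩ <;>
      simp only [tie, Function.update_apply] at * <;> grind
  · refine ⟨⟨h1, h2, h3, h4, h5⟩, h6, ?_, fun i hi hin hki => h8 i hi hin (by omega)⟩
    intro i hi hin hik
    rcases Nat.lt_succ_iff_lt_or_eq.1 hik with h | rfl
    · exact h7 i hi hin h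
    · clear h1 h2 h3 h4 h5 h6 h7 h8
      simp only [tie] at *
      grind

theorem toGogStep_mem {n k : ℕ} (hk : 1 ≤ k) (hkn : k + 2 ≤ n) {p : (ℕ → ℕ) × (ℕ → ℕ)}
    (hp : p ∈ mixedColumns n (k + 1)) : toGogStep k p ∈ mixedColumns n k := by
  obtain ⟨a, b⟩ := p
  obtain ⟨⟨h1, h2, h3, h4, h5⟩, h6, h7, h8⟩ := hp
  simp only at h1 h2 h3 h4 h5 h6 h7 h8
  unfold toGogStep
  have e1 := h6 k hk (by omega)
  have e2 := h6 (k + 1) (by omega) (by omega)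
  have e3 := h7 k hk hkn (by omega)
  have e4 := h4 k hk (by omega)
  have e5 := h4 (k + 1) (by omega) (by omega)
  split_ifs with hc
  · simp only at hc
    refine ⟨⟨?_, ?_, ?_, ?_, ?_⟩, ?_, ?_, ?_⟩ <;>
      simp only [tie, Function.update_apply] at * <;> grind
  · refine ⟨⟨h1, h2, h3, h4, h5⟩, h6, fun i hi hin hki => h7 i hi hin (by omega), ?_⟩
    intro i hi hin hik
    rcases hik.lt_or_eq with h | rfl
    · exact h8 i hi hin h
    · clear h1 h2 h3 h4 h5 h6 h7 h8
      simp only [tie] at *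
      grind

theorem toGogStep_toGOGAmStep {n k : ℕ} (hk : 1 ≤ k) (hkn : k + 2 ≤ n)
    {p : (ℕ → ℕ) × (ℕ → ℕ)} (hp : p ∈ mixedColumns n k) :
    toGogStep k (toGOGAmStep k p) = p := by
  obtain ⟨a, b⟩ := p
  obtain ⟨-, h6, h7, h8⟩ := hp
  have e1 := h6 k hk (by omega)
  have e3 := h8 k hk hkn le_rfl
  simp only [tie] at e1 e3
  refine Prod.ext (funext fun i => ?_) (funext fun i => ?_) <;>
    simp only [toGogStep, toGOGAmStep] <;> split_ifs <;>
    simp only [Function.update_apply] at * <;> grind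

theorem toGOGAmStep_toGogStep {n k : ℕ} (hk : 1 ≤ k) (hkn : k + 2 ≤ n)
    {p : (ℕ → ℕ) × (ℕ → ℕ)} (hp : p ∈ mixedColumns n (k + 1)) :
    toGOGAmStep k (toGogStep k p) = p := by
  obtain ⟨a, b⟩ := p
  obtain ⟨-, h6, h7, h8⟩ := hp
  have e1 := h6 k hk (by omega)
  have e3 := h7 k hk hkn (by omega)
  simp only [tie] at e1 e3
  refine Prod.ext (funext fun i => ?_) (funext fun i => ?_) <;>
    simp only [toGogStep, toGOGAmStep] <;> split_ifs <;>
    simp only [Function.update_apply] at * <;> grind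

theorem ncard_mixedColumns_succ (n k : ℕ) (hk : 1 ≤ k) :
    (mixedColumns n k).ncard = (mixedColumns n (k + 1)).ncard := by
  by_cases hkn : k + 2 ≤ n
  · exact Set.ncard_congr (fun p _ => toGOGAmStep k p) (fun p hp => toGOGAmStep_mem hk hkn hp)
      (fun p q hp hq h => by
        rw [← toGogStep_toGOGAmStep hk hkn hp, h, toGogStep_toGOGAmStep hk hkn hq])
      (fun q hq => ⟨toGogStep k q, toGogStep_mem hk hkn hq, toGOGAmStep_toGogStep hk hkn hq⟩)
  · congr 1
    ext p
    refine and_congr_right fun _ => and_congr_right fun _ => and_congr ?_ ?_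
    · exact forall_congr' fun i => by grind
    · exact forall_congr' fun i => by grind

theorem ncard_gogamColumns (n : ℕ) : (gogamColumns n).ncard = (mixedColumns n n).ncard := by
  refine Set.ncard_congr
    (fun p _ => (p.1, fun i => if 2 ≤ i ∧ i ≤ n then p.2 i + tie p.1 (i - 1) else 0)) ?_ ?_ ?_
  · rintro ⟨a, b⟩ ⟨⟨h1, h2, h3, h4, h5⟩, h6, h7⟩
    simp only at h1 h2 h3 h4 h5 h6 h7
    refine ⟨⟨h1, ?_, h3, h4, h5⟩, ?_, ?_, ?_⟩ <;> simp only
    · grind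
    · intro i hi hin
      have := h6 i hi hin
      rw [if_pos (by omega), Nat.add_sub_cancel]
      omega
    · intro i hi hin _
      have := h7 i hi hin
      rw [if_pos (by omega), if_pos (by omega)]
      simp only [Nat.add_sub_cancel, show i + 2 - 1 = i + 1 by omega]
      omega
    · omega
  · rintro ⟨a, b⟩ ⟨a', b'⟩ ⟨⟨-, h2, -⟩, -⟩ ⟨⟨-, h2', -⟩, -⟩ h
    simp only [Prod.mk.injEq] at h h2 h2' ⊢
    obtain ⟨rfl, h⟩ := h
    refine ⟨rfl, funext fun i => ?_⟩
    have := congrFun h i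
    by_cases hi : 2 ≤ i ∧ i ≤ n
    · rw [if_pos hi, if_pos hi] at this
      omega
    · rw [h2 i (by omega), h2' i (by omega)]
  · rintro ⟨a, b⟩ ⟨⟨h1, h2, h3, h4, h5⟩, h6, h7, h8⟩
    simp only at h1 h2 h3 h4 h5 h6 h7 h8
    refine ⟨(a, fun i => b i - tie a (i - 1)),
      ⟨⟨h1, fun i hi => by simp [h2 i hi], h3, h4, h5⟩, ?_, ?_⟩, ?_⟩
    · intro i hi hin
      have := h6 i hi hin
      simp only [Nat.add_sub_cancel]
      omega
    · intro i hi hin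
      have := h7 i hi hin (by omega)
      have := h6 i hi (by omega)
      simp only [Nat.add_sub_cancel, show i + 2 - 1 = i + 1 by omega]
      omega
    · refine Prod.ext rfl (funext fun i => ?_)
      simp only
      split_ifs with hi
      · have := h6 (i - 1) (by omega) (by omega)
        rw [show i - 1 + 1 = i by omega] at this
        omega
      · exact (h2 i (by omega)).symm

theorem IsGT.le_add_diag {n : ℕ} {Z : ℕ → ℕ → ℕ} (hZ : IsGT n Z) {i j : ℕ} (hj : 1 ≤ j)
    (hji : j ≤ i) (d : ℕ) (hd : i + d ≤ n) : Z i j ≤ Z (i + d) (j + d) := by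
  induction d with
  | zero => exact le_rfl
  | succ d ih => exact (ih (by omega)).trans (hZ.2 _ _ (by omega) (by omega) (by omega)).2

/-- A truncation to the first two columns is recovered from these columns. -/
theorem eq_arrayOfColumns_of_truncation {n : ℕ} {X Z : ℕ → ℕ → ℕ}
    (h : ∀ i j, X i j = if 1 ≤ j ∧ j ≤ i ∧ i ≤ n ∧ j ≤ 2 then Z i j else 0) :
    X = arrayOfColumns (fun i => X i 1, fun i => X i 2) := by
  funext i j
  simp only [arrayOfColumns]
  split_ifs with h1 h2
  · rw [h1]
  · rw [h2]
  · rw [h, if_neg (by omega)]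

theorem leftGogTrapSet_eq_image (n : ℕ) (hn : 1 ≤ n) :
    LeftGogTrapSet n 2 = arrayOfColumns '' mixedColumns n 1 := by
  ext X
  constructor
  · rintro ⟨Z, ⟨hZ, hs, ht⟩, hX⟩
    refine ⟨(fun i => X i 1, fun i => X i 2), ?_, (eq_arrayOfColumns_of_truncation hX).symm⟩
    have x1 : ∀ i, 1 ≤ i → i ≤ n → X i 1 = Z i 1 := fun i h h' => by rw [hX, if_pos (by omega)]
    have x2 : ∀ i, 2 ≤ i → i ≤ n → X i 2 = Z i 2 := fun i h h' => by rw [hX, if_pos (by omega)]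
    refine ⟨⟨?_, ?_, ?_, ?_, ?_⟩, ?_, ?_, ?_⟩ <;> simp only
    · intro i hi
      rw [hX, if_neg (by omega)]
    · intro i hi
      rw [hX, if_neg (by omega)]
    · intro i hi hin
      rw [x1 i hi hin]
      exact hZ.1 i 1 le_rfl hi hin
    · intro i hi hin
      rw [x1 i hi (by omega), x1 (i + 1) (by omega) hin]
      exact (hZ.2 i 1 le_rfl hi hin).1
    · rw [x1 n hn le_rfl, ht 1 le_rfl hn]
    · intro i hi hin
      have u := hZ.le_add_diag (i := i + 1) (j := 2) (by omega) (by omega) (n - (i + 1)) (by omega)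
      rw [show i + 1 + (n - (i + 1)) = n by omega, ht _ (by omega) (by omega)] at u
      have v := (hZ.2 i 1 le_rfl hi hin).2
      have w := hs (i + 1) 1 le_rfl (by omega) hin
      simp only [tie, x1 i hi (by omega), x1 (i + 1) (by omega) hin, x2 (i + 1) (by omega) hin]
      simp only [Nat.reduceAdd] at v w
      split_ifs <;> omega
    · omega
    · intro i hi hin _
      rw [x2 (i + 1) (by omega) (by omega), x2 (i + 2) (by omega) hin]
      exact (hZ.2 (i + 1) 2 (by omega) (by omega) hin).1
  · rintro ⟨⟨a, b⟩, ⟨⟨h1, h2, h3, h4, h5⟩, h6, -, h8⟩, rfl⟩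
    simp only at h1 h2 h3 h4 h5 h6 h8
    refine ⟨fun i j => if j = 1 then a i else if j = 2 then b i else j + n - i, ?_, ?_⟩
    · have hb : ∀ i, 2 ≤ i → i ≤ n → a i + 1 ≤ b i ∧ b i + i ≤ n + 2 := by
        intro i hi hin
        have := h6 (i - 1) (by omega) (by omega)
        have := h4 (i - 1) (by omega) (by omega)
        simp only [tie, show i - 1 + 1 = i by omega] at *
        split_ifs at * <;> omega
      refine ⟨⟨?_, ?_⟩, ?_, ?_⟩
      · intro i j hj hji hin
        have := h3 i (by omega) hin
        have := hb i
        simp only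
        split_ifs <;> omega
      · intro i j hj hji hin
        have := h4 i (by omega) hin
        have := hb i
        have := h6 i (by omega) hin
        have := h8 (i - 1)
        rw [show i - 1 + 2 = i + 1 by omega, show i - 1 + 1 = i by omega] at this
        simp only
        constructor <;> split_ifs <;> omega
      · intro i j hj hji hin
        have := hb i
        simp only
        split_ifs <;> omega
      · intro j hj hjn
        have := hb n
        simp only
        split_ifs <;> omega
    · intro i j
      have := h1 i
      have := h2 i
      simp only [arrayOfColumns]
      split_ifs <;> omega

/-- The GOGAm condition for a sequence ending in column `2`, along the rows `m + 1`, `m + 2`. -/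
theorem IsGOGAm.second_column_le {n : ℕ} {Z : ℕ → ℕ → ℕ} (hZ : IsGOGAm n Z) {m : ℕ}
    (hm : 1 ≤ m) (hmn : m + 2 ≤ n) : Z (m + 2) 2 + m ≤ n := by
  obtain ⟨hG, -, h⟩ := hZ
  have := h (n - m) (by omega) (by omega) (fun i => if i = 0 then n else m + 2 - i) (by simp)
    (by intro i hi; rw [if_neg (Nat.succ_ne_zero i)]; split_ifs <;> omega)
    (by rw [if_neg (by omega)]; omega)
  rw [show n - (n - m) = m by omega] at this
  have key : 0 ≤ ∑ i ∈ Finset.range m,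
      ((Z ((if i = 0 then n else m + 2 - i) + i) (if i = 0 then n else m + 2 - i) : ℤ) -
        (Z ((if i + 1 = 0 then n else m + 2 - (i + 1)) + i)
          (if i + 1 = 0 then n else m + 2 - (i + 1)) : ℤ)) := by
    refine Finset.sum_nonneg fun i hi => ?_
    rw [Finset.mem_range] at hi
    rw [sub_nonneg, Nat.cast_le, if_neg (by omega), show m + 2 - (i + 1) + i = m + 1 by omega]
    split_ifs with h0
    · subst h0
      have := hG.le_add_diag (i := m + 1) (j := m + 1) (by omega) le_rfl (n - (m + 1)) (by omega)
      rwa [show m + 1 + (n - (m + 1)) = n by omega] at this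
    · have := (hG.2 (m + 1) (m + 2 - (i + 1)) (by omega) (by omega) (by omega)).2
      rw [show m + 2 - i + i = m + 1 + 1 by omega]
      rwa [show m + 2 - (i + 1) + 1 = m + 2 - i by omega] at this
  rw [if_neg (by omega : m ≠ 0), show m + 2 - m = 2 by omega, add_comm 2 m] at this
  omega

/-- The GOGAm condition for a sequence ending in column `1`, along the rows `m`, `m + 1`. -/
theorem IsGOGAm.first_columns_le {n : ℕ} {Z : ℕ → ℕ → ℕ} (hZ : IsGOGAm n Z) {m : ℕ}
    (hm : 1 ≤ m) (hmn : m + 1 ≤ n) : Z (m + 1) 2 + Z (m + 1) 1 + m ≤ n + Z m 1 := by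
  obtain ⟨hG, -, h⟩ := hZ
  have := h (n - m) (by omega) (by omega) (fun i => if i = 0 then n else m + 1 - i) (by simp)
    (by intro i hi; rw [if_neg (Nat.succ_ne_zero i)]; split_ifs <;> omega)
    (by rw [if_neg (by omega)]; omega)
  rw [show n - (n - m) = m by omega] at this
  obtain ⟨m, rfl⟩ : ∃ l, m = l + 1 := ⟨m - 1, by omega⟩
  have key : 0 ≤ ∑ i ∈ Finset.range m,
      ((Z ((if i = 0 then n else m + 1 + 1 - i) + i) (if i = 0 then n else m + 1 + 1 - i) : ℤ) -
        (Z ((if i + 1 = 0 then n else m + 1 + 1 - (i + 1)) + i)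
          (if i + 1 = 0 then n else m + 1 + 1 - (i + 1)) : ℤ)) := by
    refine Finset.sum_nonneg fun i hi => ?_
    rw [Finset.mem_range] at hi
    rw [sub_nonneg, Nat.cast_le, if_neg (by omega),
      show m + 1 + 1 - (i + 1) + i = m + 1 by omega]
    split_ifs with h0
    · subst h0
      have := hG.le_add_diag (i := m + 1) (j := m + 1) (by omega) le_rfl (n - (m + 1)) (by omega)
      rwa [show m + 1 + (n - (m + 1)) = n by omega] at this
    · have := (hG.2 (m + 1) (m + 1 + 1 - (i + 1)) (by omega) (by omega) (by omega)).2
      rw [show m + 1 + 1 - i + i = m + 1 + 1 by omega]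
      rwa [show m + 1 + 1 - (i + 1) + 1 = m + 1 + 1 - i by omega] at this
  have last : Z (m + 1 + 1) 2 ≤
      Z ((if m = 0 then n else m + 1 + 1 - m) + m) (if m = 0 then n else m + 1 + 1 - m) := by
    split_ifs with h0
    · subst h0
      have := hG.le_add_diag (i := 2) (j := 2) (by omega) le_rfl (n - 2) (by omega)
      rwa [show 2 + (n - 2) = n by omega] at this
    · rw [show m + 1 + 1 - m = 2 by omega, show 2 + m = m + 1 + 1 by omega]
  rw [Finset.sum_range_succ] at this
  simp only [if_neg (Nat.succ_ne_zero m), show m + 1 + 1 - (m + 1) = 1 by omega,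
    show 1 + m = m + 1 by omega, show 1 + (m + 1) = m + 1 + 1 by omega] at this
  omega

/-- The smallest Gelfand-Tsetlin triangle with given first two columns is GOGAm. -/
theorem isGOGAm_of_mem_gogamColumns {n : ℕ} (hn : 1 ≤ n) {a b : ℕ → ℕ}
    (h : (a, b) ∈ gogamColumns n) :
    IsGOGAm n (fun i j => if j = 1 then a i else b (i + 2 - j)) := by
  obtain ⟨⟨-, -, h3, h4, h5⟩, h6, h7⟩ := h
  simp only at h3 h4 h5 h6 h7
  have hb : ∀ i, 2 ≤ i → i ≤ n → 1 ≤ b i ∧ b i + i ≤ n + 2 := by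
    intro i hi hin
    have := h6 (i - 1) (by omega) (by omega)
    have := h3 (i - 1) (by omega) (by omega)
    rw [show i - 1 + 1 = i by omega] at *
    omega
  refine ⟨⟨?_, ?_⟩, ?_, ?_⟩
  · intro i j hj hji hin
    simp only
    split_ifs
    · exact h3 i (by omega) hin
    · exact (hb _ (by omega) (by omega)).1
  · intro i j hj hji hin
    simp only
    rw [if_neg (by omega : j + 1 ≠ 1)]
    split_ifs with h0
    · subst h0
      exact ⟨h4 i hji hin, (h6 i hji hin).1⟩
    · rw [show i + 1 + 2 - (j + 1) = i + 2 - j by omega]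
      have := h7 (i + 1 - j) (by omega) (by omega)
      rw [show i + 1 - j + 2 = i + 1 + 2 - j by omega,
        show i + 1 - j + 1 = i + 2 - j by omega] at this
      exact ⟨this, le_rfl⟩
  · simp only
    split_ifs with h0
    · omega
    · rw [show n + 2 - n = 2 by omega]
      have := hb 2 le_rfl (by omega)
      omega
  · intro k hk hkn j hj0 hj hjl
    obtain ⟨m, hm⟩ : ∃ m, n - k = m + 1 := ⟨n - k - 1, by omega⟩
    rw [hm] at hj hjl ⊢
    have hge : ∀ d, d ≤ m + 1 → d + 1 ≤ j (m + 1 - d) := by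
      intro d
      induction d with
      | zero => simpa using hjl
      | succ d ih =>
        intro hd
        have h1 := ih (by omega)
        have h2 := hj (m + 1 - (d + 1)) (by omega)
        rw [show m + 1 - (d + 1) + 1 = m + 1 - d by omega] at h2
        omega
    have hle : ∀ d, d ≤ m + 1 → j d + d ≤ n := by
      intro d
      induction d with
      | zero => simp [hj0]
      | succ d ih =>
        intro hd
        have h1 := ih (by omega)
        have h2 := hj d (by omega)
        omega
    have hge2 : ∀ i, i ≤ m → 2 ≤ j i := by
      intro i hi
      have := hge (m + 1 - i) (by omega)
      rw [show m + 1 - (m + 1 - i) = i by omega] at this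
      omega
    have hbj : ∀ l i, 2 ≤ j l → (if j l = 1 then a (j l + i) else b (j l + i + 2 - j l))
        = b (i + 2) := by
      intro l i hl
      rw [if_neg (by omega), show j l + i + 2 - j l = i + 2 by omega]
    have hz : ∑ i ∈ Finset.range m,
        (((if j i = 1 then a (j i + i) else b (j i + i + 2 - j i) : ℕ) : ℤ) -
          ((if j (i + 1) = 1 then a (j (i + 1) + i) else b (j (i + 1) + i + 2 - j (i + 1)) : ℕ)
            : ℤ)) = 0 := by
      refine Finset.sum_eq_zero fun i hi => ?_
      rw [Finset.mem_range] at hi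
      rw [hbj _ _ (hge2 i (by omega)), hbj _ _ (hge2 (i + 1) (by omega)), sub_self]
    rw [Finset.sum_range_succ, hz]
    simp only
    rw [hbj m m (hge2 m le_rfl)]
    have hl := hle (m + 1) le_rfl
    by_cases h1 : j (m + 1) = 1
    · simp only [h1, if_true]
      have e1 := h6 (m + 1) (by omega) (by omega)
      have e2 := h4 (m + 1) (by omega) (by omega)
      simp only [tie, show 1 + m = m + 1 by omega, show 1 + (m + 1) = m + 1 + 1 by omega,
        show m + 1 + 1 = m + 2 by omega] at *
      split_ifs at e1 <;> omega
    · rw [hbj _ _ (by omega), hbj _ _ (by omega)]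
      have := hb (m + 1 + 2) (by omega) (by omega)
      omega

theorem leftGOGAmTrapSet_eq_image (n : ℕ) (hn : 1 ≤ n) :
    LeftGOGAmTrapSet n 2 = arrayOfColumns '' gogamColumns n := by
  ext X
  constructor
  · rintro ⟨Z, hZ, hX⟩
    refine ⟨(fun i => X i 1, fun i => X i 2), ?_, (eq_arrayOfColumns_of_truncation hX).symm⟩
    have x1 : ∀ i, 1 ≤ i → i ≤ n → X i 1 = Z i 1 := fun i h h' => by rw [hX, if_pos (by omega)]
    have x2 : ∀ i, 2 ≤ i → i ≤ n → X i 2 = Z i 2 := fun i h h' => by rw [hX, if_pos (by omega)]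
    have hG := hZ.1
    refine ⟨⟨?_, ?_, ?_, ?_, ?_⟩, ?_, ?_⟩ <;> simp only
    · intro i hi
      rw [hX, if_neg (by omega)]
    · intro i hi
      rw [hX, if_neg (by omega)]
    · intro i hi hin
      rw [x1 i hi hin]
      exact hG.1 i 1 le_rfl hi hin
    · intro i hi hin
      rw [x1 i hi (by omega), x1 (i + 1) (by omega) hin]
      exact (hG.2 i 1 le_rfl hi hin).1
    · rw [x1 n hn le_rfl]
      have h1 := hG.1 n 1 le_rfl hn le_rfl
      rcases hn.eq_or_lt with rfl | hn'
      · exact le_antisymm hZ.2.1 h1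
      · obtain ⟨m, rfl⟩ : ∃ m, n = m + 1 := ⟨n - 1, by omega⟩
        have h2 := hZ.first_columns_le (m := m) (by omega) le_rfl
        have h3 := (hG.2 m 1 le_rfl (by omega) le_rfl).2
        simp only [Nat.reduceAdd] at h3
        omega
    · intro i hi hin
      have h1 := hZ.first_columns_le hi hin
      have h2 := hG.2 i 1 le_rfl hi hin
      have h3 : Z (i + 1) 2 + i ≤ n + 1 := by
        rcases hi.eq_or_lt with rfl | hi'
        · have := hG.le_add_diag (i := 2) (j := 2) (by omega) le_rfl (n - 2) (by omega)
          rw [show 2 + (n - 2) = n by omega] at this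
          have := hZ.2.1
          simp only [Nat.reduceAdd]
          omega
        · have := hZ.second_column_le (m := i - 1) (by omega) (by omega)
          rw [show i - 1 + 2 = i + 1 by omega] at this
          omega
      simp only [tie, x1 i hi (by omega), x1 (i + 1) (by omega) hin, x2 (i + 1) (by omega) hin]
      simp only [Nat.reduceAdd] at h2
      split_ifs <;> omega
    · intro i hi hin
      rw [x2 (i + 1) (by omega) (by omega), x2 (i + 2) (by omega) hin]
      exact (hG.2 (i + 1) 2 (by omega) (by omega) hin).1
  · rintro ⟨⟨a, b⟩, h, rfl⟩
    refine ⟨_, isGOGAm_of_mem_gogamColumns hn h, ?_⟩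
    obtain ⟨⟨h1, h2, -⟩, -⟩ := h
    simp only at h1 h2
    intro i j
    have := h1 i
    have := h2 i
    simp only [arrayOfColumns]
    by_cases hj : j = 2
    · subst hj
      simp only [Nat.add_sub_cancel]
      split_ifs <;> omega
    · split_ifs <;> omega

/-- For every `n ≥ 1`, the `(n,2)` left Gog and left GOGAm trapezoids are
equienumerated. -/
theorem left_gog_gogam_trapezoids_width2_equienumerated (n : ℕ) (hn : 1 ≤ n) :
    (LeftGogTrapSet n 2).ncard = (LeftGOGAmTrapSet n 2).ncard := by
  rw [leftGogTrapSet_eq_image n hn, leftGOGAmTrapSet_eq_image n hn,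
    Set.ncard_image_of_injective _ arrayOfColumns_injective,
    Set.ncard_image_of_injective _ arrayOfColumns_injective, ncard_gogamColumns n]
  have h : ∀ k, 1 ≤ k → (mixedColumns n 1).ncard = (mixedColumns n k).ncard :=
    fun k hk => Nat.le_induction rfl
      (fun k hk ih => ih.trans (ncard_mixedColumns_succ n k hk)) k hk
  exact h n hn
end

section
/- Let n, k, l satisfy k + l ≤ n + 1 and let X be an (n,k,l) GOGAm rectangle. Then there exists a minimal GOGAm triangle of size n extending X: a GOGAm triangle Y whose restriction to the entries with j ≤ k and i−j ≤ l−1 equals X, such that every GOGAm triangle Z of size n extending X satches Y ≤ Z entrywise. -/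
/-- Entries of a Gelfand-Tsetlin triangle increase along each SW-NE diagonal. -/
theorem IsGT.diagonal_mono {n : ℕ} {Z : ℕ → ℕ → ℕ} (hZ : IsGT n Z) (d : ℕ) {a b : ℕ}
    (ha : 1 ≤ a) (hab : a ≤ b) (hb : b + d ≤ n) : Z (a + d) a ≤ Z (b + d) b := by
  induction b, hab using Nat.le_induction with
  | base => exact le_rfl
  | succ b hab ih =>
    have h := (hZ.2 (b + d) b (by omega) (by omega) (by omega)).2
    rw [show b + d + 1 = b + 1 + d by omega] at h
    exact (ih (by omega)).trans h

/-- If the diagonals of `Y` grow no faster than those of `Z` and `Y ≤ Z`, then the GOGAm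
inequalities pass from `Z` to `Y`. -/
theorem IsGOGAm.of_diagonal_sub_le {n : ℕ} {Y Z : ℕ → ℕ → ℕ} (hn : 1 ≤ n) (hZ : IsGOGAm n Z)
    (hY : IsGT n Y)
    (hle : ∀ d a, 1 ≤ a → a + d ≤ n → Y (a + d) a ≤ Z (a + d) a)
    (hsub : ∀ d a b, 1 ≤ a → a ≤ b → b + d ≤ n →
      (Y (b + d) b : ℤ) - Y (a + d) a ≤ (Z (b + d) b : ℤ) - Z (a + d) a) :
    IsGOGAm n Y := by
  refine ⟨hY, (hle 0 n hn le_rfl).trans hZ.2.1, fun p hp hpn j hj0 hj hj1 => ?_⟩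
  have hupper : ∀ i, i ≤ n - p → j i + i ≤ n := by
    intro i
    induction i with
    | zero => omega
    | succ i ih =>
      intro hi
      have := ih (by omega)
      have := hj i (by omega)
      omega
  have hpos : ∀ i, i ≤ n - p → 1 ≤ j i := by
    intro i hi
    rcases hi.lt_or_eq with hi | rfl
    · have := hj i hi
      omega
    · exact hj1
  refine le_trans (add_le_add (Finset.sum_le_sum fun i hi => ?_) ?_) (hZ.2.2 p hp hpn j hj0 hj hj1)
  · have hi := Finset.mem_range.mp hi
    exact hsub i _ _ (hpos _ hi) (hj i hi).le (hupper i hi.le)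
  · exact_mod_cast hle _ _ hj1 (hupper _ le_rfl)

/-- The triangle which agrees with `Z` on the `(n, k, l)` rectangle, is constant along the `l`
rightmost SW-NE diagonals beyond column `k`, and equals `1` elsewhere. -/
def rectangleMinCompletion (k l : ℕ) (Z : ℕ → ℕ → ℕ) (i j : ℕ) : ℕ :=
  if i < j + l then Z (min j k + (i - j)) (min j k) else 1

theorem rectangleMinCompletion_diagonal (k l : ℕ) (Z : ℕ → ℕ → ℕ) (d a : ℕ) :
    rectangleMinCompletion k l Z (a + d) a =
      if d < l then Z (min a k + d) (min a k) else 1 := by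
  simp [rectangleMinCompletion]

theorem rectangleMinCompletion_of_mem {k l i j : ℕ} (Z : ℕ → ℕ → ℕ) (hji : j ≤ i) (hjk : j ≤ k)
    (hij : i < j + l) : rectangleMinCompletion k l Z i j = Z i j := by
  simp [rectangleMinCompletion, hij, hjk, hji]

theorem IsGT.rectangleMinCompletion_le {n k l : ℕ} {Z W : ℕ → ℕ → ℕ} (hk : 1 ≤ k)
    (hW : IsGT n W)
    (hWZ : ∀ i j, 1 ≤ j → j ≤ i → i ≤ n → j ≤ k → i < j + l → W i j = Z i j)
    (d a : ℕ) (ha : 1 ≤ a) (had : a + d ≤ n) :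
    rectangleMinCompletion k l Z (a + d) a ≤ W (a + d) a := by
  rw [rectangleMinCompletion_diagonal]
  split_ifs with hd
  · rw [← hWZ _ _ (by omega) (by omega) (by omega) (by omega) (by omega)]
    exact hW.diagonal_mono d (by omega) (by omega) had
  · exact hW.1 _ _ ha (by omega) had

theorem IsGT.rectangleMinCompletion {n k l : ℕ} {Z : ℕ → ℕ → ℕ} (hk : 1 ≤ k)
    (hZ : IsGT n Z) : IsGT n (rectangleMinCompletion k l Z) := by
  refine ⟨fun i j hj hji hi => ?_, fun i j hj hji hi => ?_⟩
  · obtain ⟨d, rfl⟩ := Nat.exists_eq_add_of_le hji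
    rw [rectangleMinCompletion_diagonal]
    split_ifs
    · exact hZ.1 _ _ (by omega) (by omega) (by omega)
    · exact le_rfl
  · obtain ⟨d, rfl⟩ := Nat.exists_eq_add_of_le hji
    constructor
    · rw [add_assoc, rectangleMinCompletion_diagonal, rectangleMinCompletion_diagonal]
      split_ifs
      · exact (hZ.2 (min j k + d) _ (by omega) (by omega) (by omega)).1
      · omega
      · exact hZ.1 _ _ (by omega) (by omega) (by omega)
      · exact le_rfl
    · rw [add_right_comm, rectangleMinCompletion_diagonal, rectangleMinCompletion_diagonal]
      split_ifs
      · exact hZ.diagonal_mono d (by omega) (by omega) (by omega)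
      · exact le_rfl

theorem IsGT.rectangleMinCompletion_sub_le {n k l : ℕ} {Z : ℕ → ℕ → ℕ} (hk : 1 ≤ k)
    (hZ : IsGT n Z) (d a b : ℕ) (ha : 1 ≤ a) (hab : a ≤ b) (hb : b + d ≤ n) :
    (_root_.rectangleMinCompletion k l Z (b + d) b : ℤ)
        - _root_.rectangleMinCompletion k l Z (a + d) a
      ≤ (Z (b + d) b : ℤ) - Z (a + d) a := by
  have hmono := hZ.diagonal_mono d ha hab hb
  rw [rectangleMinCompletion_diagonal, rectangleMinCompletion_diagonal]
  split_ifs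
  · rcases le_total a k with hak | hka
    · have := hZ.diagonal_mono d (a := min b k) (b := b) (by omega) (by omega) hb
      rw [min_eq_left hak]
      omega
    · rw [min_eq_right hka, min_eq_right (hka.trans hab)]
      omega
  · omega

/-- Let `k + l ≤ n + 1` and let `X` be an `(n,k,l)` GOGAm rectangle (i.e. it agrees
with some GOGAm triangle of size `n` on the intersection of the `k` leftmost NW-SE
diagonals `j ≤ k` and the `l` rightmost SW-NE diagonals `i - j ≤ l - 1`). Then there
exists a minimal GOGAm triangle of size `n` extending `X`. -/
theorem gogam_rectangle_min_completion (n k l : ℕ) (hk : 1 ≤ k) (hl : 1 ≤ l)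
    (hkl : k + l ≤ n + 1) (X : ℕ → ℕ → ℕ)
    (hX : ∃ Z, IsGOGAm n Z ∧
      ∀ i j, 1 ≤ j → j ≤ i → i ≤ n → j ≤ k → i < j + l → X i j = Z i j) :
    ∃ Y, IsGOGAm n Y ∧
      (∀ i j, 1 ≤ j → j ≤ i → i ≤ n → j ≤ k → i < j + l → Y i j = X i j) ∧
      ∀ Z : ℕ → ℕ → ℕ, IsGOGAm n Z →
        (∀ i j, 1 ≤ j → j ≤ i → i ≤ n → j ≤ k → i < j + l → Z i j = X i j) →
        ∀ i j, 1 ≤ j → j ≤ i → i ≤ n → Y i j ≤ Z i j := by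
  obtain ⟨Z, hZ, hXZ⟩ := hX
  refine ⟨rectangleMinCompletion k l Z,
    hZ.of_diagonal_sub_le (by omega) (hZ.1.rectangleMinCompletion hk)
      (hZ.1.rectangleMinCompletion_le hk fun _ _ _ _ _ _ _ => rfl)
      (hZ.1.rectangleMinCompletion_sub_le hk),
    fun i j hj hji hi hjk hij => ?_, fun W hW hWX i j hj hji hi => ?_⟩
  · rw [hXZ i j hj hji hi hjk hij, rectangleMinCompletion_of_mem Z hji hjk hij]
  · obtain ⟨d, rfl⟩ := Nat.exists_eq_add_of_le hji
    exact hW.1.rectangleMinCompletion_le hk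
      (fun i j h₁ h₂ h₃ h₄ h₅ => (hWX i j h₁ h₂ h₃ h₄ h₅).trans (hXZ i j h₁ h₂ h₃ h₄ h₅))
      d j hj hi
end

section
/- For every n and every l with 2 + l ≤ n + 1, the number of (n,2,l) Gog rectangles equals the number of (n,2,l) GOGAm rectangles. -/
/-- The set of `(n,k,l)` Gog rectangles, encoded as functions agreeing with some Gog
triangle of size `n` on the intersection of the `k` leftmost NW-SE diagonals and the
`l` rightmost SW-NE diagonals, and vanishing elsewhere. -/
def GogRectSet (n k l : ℕ) : Set (ℕ → ℕ → ℕ) :=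
  { X | ∃ Z, IsGog n Z ∧
      ∀ i j, X i j = if 1 ≤ j ∧ j ≤ i ∧ i ≤ n ∧ j ≤ k ∧ i < j + l then Z i j else 0 }

/-- The set of `(n,k,l)` GOGAm rectangles, encoded as functions agreeing with some
GOGAm triangle of size `n` on the intersection of the `k` leftmost NW-SE diagonals
and the `l` rightmost SW-NE diagonals, and vanishing elsewhere. -/
def GOGAmRectSet (n k l : ℕ) : Set (ℕ → ℕ → ℕ) :=
  { X | ∃ Z, IsGOGAm n Z ∧
      ∀ i j, X i j = if 1 ≤ j ∧ j ≤ i ∧ i ≤ n ∧ j ≤ k ∧ i < j + l then Z i j else 0 }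

/-- Indicator that the sequence `a` does not change between `m` and `m + 1`. -/
def flat (a : ℕ → ℕ) (m : ℕ) : ℕ := if a m = a (m + 1) then 1 else 0

/-- Pairs of sequences `(a, c)` interpolating between Gog rectangles (`k = 0`) and GOGAm
rectangles (`k = l`) with two columns. The column `c` is weakly decreasing on its first `k`
steps, and `c + flat a` is weakly decreasing on the remaining ones. -/
def hybridSet (n l k : ℕ) : Set ((ℕ → ℕ) × (ℕ → ℕ)) :=
  { p | (∀ m, l ≤ m → p.1 m = 1 ∧ p.2 m = 0) ∧
    (∀ m, m < l → 1 ≤ p.1 m ∧ p.1 (m + 1) ≤ p.1 m ∧ p.1 m ≤ p.2 m ∧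
      p.2 m + flat p.1 m + m ≤ n) ∧
    ∀ m, m + 1 < l →
      (m < k → p.2 (m + 1) ≤ p.2 m) ∧
      (k ≤ m → p.2 (m + 1) + flat p.1 (m + 1) ≤ p.2 m + flat p.1 m) }

/-- The involution moving a flat step of the first sequence across position `k + 1`. -/
def toggle (k : ℕ) (p : (ℕ → ℕ) × (ℕ → ℕ)) : (ℕ → ℕ) × (ℕ → ℕ) :=
  if p.1 k = p.1 (k + 1) ∧ p.1 (k + 1) ≠ p.1 (k + 2) ∧ p.2 (k + 1) = p.2 k + 1 then
    (Function.update p.1 (k + 1) (p.1 (k + 2)), Function.update p.2 (k + 1) (p.2 k))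
  else if p.1 k ≠ p.1 (k + 1) ∧ p.1 (k + 1) = p.1 (k + 2) ∧ p.2 (k + 1) = p.2 k then
    (Function.update p.1 (k + 1) (p.1 k), Function.update p.2 (k + 1) (p.2 k + 1))
  else p

theorem toggle_toggle (k : ℕ) (p : (ℕ → ℕ) × (ℕ → ℕ)) : toggle k (toggle k p) = p := by
  obtain ⟨a, c⟩ := p
  by_cases h1 : a k = a (k + 1) ∧ a (k + 1) ≠ a (k + 2) ∧ c (k + 1) = c k + 1
  · simp [toggle, h1]
  · by_cases h2 : a k ≠ a (k + 1) ∧ a (k + 1) = a (k + 2) ∧ c (k + 1) = c k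
    · have h3 : a k ≠ a (k + 2) := by omega
      simp [toggle, h2, h3]
    · simp only [toggle, h1, h2, if_false]

theorem toggle_mem_hybridSet_succ {n l k : ℕ} (hk : k + 1 < l) {p : (ℕ → ℕ) × (ℕ → ℕ)}
    (hp : p ∈ hybridSet n l k) : toggle k p ∈ hybridSet n l (k + 1) := by
  obtain ⟨a, c⟩ := p
  obtain ⟨h0, h1, h2⟩ := hp
  have hk0 := h1 k (by omega)
  have hk1 := h1 (k + 1) hk
  have hk2 := (h2 k hk).2 le_rfl
  simp only [] at h0 h1 h2 hk0 hk1 hk2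
  by_cases c1 : a k = a (k + 1) ∧ a (k + 1) ≠ a (k + 2) ∧ c (k + 1) = c k + 1
  · rw [toggle, if_pos c1]
    have f0 : flat a k = 1 := if_pos c1.1
    have f1 : flat a (k + 1) = 0 := if_neg c1.2.1
    refine ⟨fun m hm => ?_, fun m hm => ?_, fun m hm => ?_⟩
    · have : m ≠ k + 1 := by omega
      simpa [this] using h0 m hm
    · have := h1 m hm
      grind [flat, Function.update_apply]
    · have := h2 m hm
      have := h1 m (by omega)
      have := h1 (m + 1) hm
      grind [flat, Function.update_apply]
  · have c2 : ¬ (a k ≠ a (k + 1) ∧ a (k + 1) = a (k + 2) ∧ c (k + 1) = c k) := by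
      grind [flat]
    rw [toggle, if_neg c1, if_neg c2]
    refine ⟨h0, h1, fun m hm => ?_⟩
    have := h2 m hm
    grind [flat]

theorem toggle_mem_hybridSet {n l k : ℕ} (hk : k + 1 < l) {p : (ℕ → ℕ) × (ℕ → ℕ)}
    (hp : p ∈ hybridSet n l (k + 1)) : toggle k p ∈ hybridSet n l k := by
  obtain ⟨a, c⟩ := p
  obtain ⟨h0, h1, h2⟩ := hp
  have hk0 := h1 k (by omega)
  have hk1 := h1 (k + 1) hk
  have hk2 := (h2 k hk).1 (by omega)
  simp only [] at h0 h1 h2 hk0 hk1 hk2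
  have c1 : ¬ (a k = a (k + 1) ∧ a (k + 1) ≠ a (k + 2) ∧ c (k + 1) = c k + 1) := by
    omega
  by_cases c2 : a k ≠ a (k + 1) ∧ a (k + 1) = a (k + 2) ∧ c (k + 1) = c k
  · rw [toggle, if_neg c1, if_pos c2]
    have f0 : flat a k = 0 := if_neg c2.1
    have f1 : flat a (k + 1) = 1 := if_pos c2.2.1
    refine ⟨fun m hm => ?_, fun m hm => ?_, fun m hm => ?_⟩
    · have : m ≠ k + 1 := by omega
      simpa [this] using h0 m hm
    · have := h1 m hm
      grind [flat, Function.update_apply]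
    · have := h2 m hm
      have := h1 m (by omega)
      have := h1 (m + 1) hm
      grind [flat, Function.update_apply]
  · rw [toggle, if_neg c1, if_neg c2]
    refine ⟨h0, h1, fun m hm => ?_⟩
    have := h2 m hm
    grind [flat]

theorem ncard_hybridSet_succ {n l k : ℕ} (hk : k + 1 < l) :
    (hybridSet n l k).ncard = (hybridSet n l (k + 1)).ncard :=
  Set.BijOn.ncard_eq (f := toggle k) <|
    Set.InvOn.bijOn (f' := toggle k) ⟨fun p _ => toggle_toggle k p, fun p _ => toggle_toggle k p⟩
      (fun _ hp => toggle_mem_hybridSet_succ hk hp) (fun _ hp => toggle_mem_hybridSet hk hp)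

theorem ncard_hybridSet {n l k : ℕ} (hk : k < l) :
    (hybridSet n l 0).ncard = (hybridSet n l k).ncard := by
  induction k with
  | zero => rfl
  | succ k ih => rw [ih (by omega), ncard_hybridSet_succ hk]

/-- The two-column rectangle with columns `a` and `b` of height `l`. -/
def twoColumns (l : ℕ) (a b : ℕ → ℕ) (i j : ℕ) : ℕ :=
  if j = 1 ∧ 1 ≤ i ∧ i ≤ l then a (i - 1)
  else if j = 2 ∧ 2 ≤ i ∧ i ≤ l + 1 then b (i - 2)
  else 0

theorem twoColumns_inj {l : ℕ} {a b a' b' : ℕ → ℕ}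
    (h : twoColumns l a b = twoColumns l a' b') (m : ℕ) (hm : m < l) :
    a m = a' m ∧ b m = b' m := by
  have h1 := congrFun (congrFun h (m + 1)) 1
  have h2 := congrFun (congrFun h (m + 2)) 2
  simp only [twoColumns] at h1 h2
  grind

theorem eq_twoColumns {n l : ℕ} (hln : l + 1 ≤ n) {X Z : ℕ → ℕ → ℕ} {a b : ℕ → ℕ}
    (hX : ∀ i j, X i j = if 1 ≤ j ∧ j ≤ i ∧ i ≤ n ∧ j ≤ 2 ∧ i < j + l then Z i j else 0)
    (ha : ∀ m, m < l → a m = Z (m + 1) 1) (hb : ∀ m, m < l → b m = Z (m + 2) 2) :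
    twoColumns l a b = X := by
  funext i j
  rw [hX, twoColumns]
  by_cases h1 : j = 1 ∧ 1 ≤ i ∧ i ≤ l
  · rw [if_pos h1, if_pos (by omega), ha _ (by omega), h1.1, Nat.sub_add_cancel h1.2.1]
  · rw [if_neg h1]
    by_cases h2 : j = 2 ∧ 2 ≤ i ∧ i ≤ l + 1
    · rw [if_pos h2, if_pos (by omega), hb _ (by omega), h2.1, Nat.sub_add_cancel h2.2.1]
    · rw [if_neg h2, if_neg (by omega)]

theorem injOn_gog {n l : ℕ} (k : ℕ) :
    Set.InjOn (fun p : (ℕ → ℕ) × (ℕ → ℕ) => twoColumns l p.1 (p.2 + flat p.1))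
      (hybridSet n l k) := by
  rintro ⟨a, c⟩ ⟨h0, -⟩ ⟨a', c'⟩ ⟨h0', -⟩ h
  have h := twoColumns_inj h
  have ha : a = a' := by
    funext m
    have := h m
    have := h0 m
    have := h0' m
    grind
  subst ha
  congr 1
  funext m
  have := h m
  have := h0 m
  have := h0' m
  simp only [Pi.add_apply] at *
  grind

theorem injOn_gogam {n l : ℕ} (k : ℕ) :
    Set.InjOn (fun p : (ℕ → ℕ) × (ℕ → ℕ) => twoColumns l p.1 p.2) (hybridSet n l k) := by
  rintro ⟨a, c⟩ ⟨h0, -⟩ ⟨a', c'⟩ ⟨h0', -⟩ h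
  have h := twoColumns_inj h
  congr 1 <;>
  · funext m
    have := h m
    have := h0 m
    have := h0' m
    grind

theorem IsGT.diagonal_mono_s19 {n : ℕ} {Z : ℕ → ℕ → ℕ} (hZ : IsGT n Z) {i j : ℕ} (m : ℕ)
    (hi : 1 ≤ i) (hij : i ≤ j) (hj : j + m ≤ n) : Z (i + m) i ≤ Z (j + m) j := by
  induction j, hij using Nat.le_induction with
  | base => rfl
  | succ j hij ih =>
    refine (ih (by omega)).trans ?_
    have := (hZ.2 (j + m) j (by omega) (by omega) (by omega)).2
    rwa [show j + 1 + m = j + m + 1 by omega]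

theorem IsGog.le {n : ℕ} {Z : ℕ → ℕ → ℕ} (hZ : IsGog n Z) {j m : ℕ}
    (hj : 1 ≤ j) (hjm : j + m ≤ n) : Z (j + m) j + m ≤ n := by
  have := hZ.1.diagonal_mono_s19 (i := j) (j := n - m) m hj (by omega) (by omega)
  rw [Nat.sub_add_cancel (by omega), hZ.2.2 (n - m) (by omega) (by omega)] at this
  omega

theorem gogRectSet_eq_image {n l : ℕ} (hln : l + 1 ≤ n) :
    GogRectSet n 2 l =
      (fun p : (ℕ → ℕ) × (ℕ → ℕ) => twoColumns l p.1 (p.2 + flat p.1)) '' hybridSet n l 0 := by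
  ext X
  constructor
  · rintro ⟨Z, hZ, hX⟩
    set a : ℕ → ℕ := fun m => if m < l then Z (m + 1) 1 else 1 with ha
    have hb : ∀ m, m < l → 1 ≤ a m ∧ a (m + 1) ≤ a m ∧ a m + flat a m ≤ Z (m + 2) 2 ∧
        Z (m + 2) 2 + m ≤ n ∧ (m + 1 < l → Z (m + 1 + 2) 2 ≤ Z (m + 2) 2) := by
      intro m hm
      have e1 := hZ.1.1 (m + 1) 1 le_rfl (by omega) (by omega)
      have e2 := hZ.1.2 (m + 1) 1 le_rfl (by omega) (by omega)
      have e3 := hZ.2.1 (m + 2) 1 le_rfl (by omega) (by omega)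
      have e4 := hZ.1.1 (m + 2) 1 le_rfl (by omega) (by omega)
      have e5 := hZ.le (j := 2) (m := m) (by omega) (by omega)
      have e6 : m + 1 < l → Z (m + 1 + 2) 2 ≤ Z (m + 2) 2 := fun h =>
        (hZ.1.2 (m + 2) 2 (by omega) (by omega) (by omega)).1
      rw [add_comm 2 m] at e5
      refine ⟨by grind, by grind, ?_, e5, e6⟩
      simp only [flat, ha]
      grind
    refine ⟨(a, fun m => if m < l then Z (m + 2) 2 - flat a m else 0), ⟨?_, ?_, ?_⟩, ?_⟩
    · intro m hm
      simp [ha, hm]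
    · intro m hm
      have := hb m hm
      simp only [hm, if_true]
      omega
    · intro m hm
      have := hb m (by omega)
      have := hb (m + 1) hm
      simp only [hm, show m < l by omega, if_true]
      omega
    · refine eq_twoColumns hln hX (fun m hm => by simp [ha, hm]) fun m hm => ?_
      have := hb m hm
      simp only [Pi.add_apply, hm, if_true]
      omega
  · rintro ⟨⟨a, c⟩, ⟨h0, h1, h2⟩, rfl⟩
    simp only [] at h0 h1 h2
    set b : ℕ → ℕ := c + flat a with hb
    have hab : ∀ m, m < l → 1 ≤ a m ∧ a (m + 1) ≤ a m ∧ a m ≤ b m ∧ a (m + 1) < b m ∧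
        b m + m ≤ n ∧ (m + 1 < l → b (m + 1) ≤ b m) ∧ 2 ≤ b m := by
      intro m hm
      have e1 := h1 m hm
      have e2 := h2 m
      have e3 : 1 ≤ a (m + 1) := by
        by_cases h : m + 1 < l
        · exact (h1 _ h).1
        · exact (h0 (m + 1) (by omega)).1.ge
      have e4 : b m = c m + flat a m := rfl
      have e5 : b (m + 1) = c (m + 1) + flat a (m + 1) := rfl
      grind [flat]
    refine ⟨fun i j => if i < j + l then (if j = 1 then a (i - j) else if j = 2 then b (i - j)
      else n + j - i) else j, ⟨⟨?_, ?_⟩, ?_, ?_⟩, ?_⟩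
    · intro i j hj hji hi
      have := hab (i - j)
      grind
    · intro i j hj hji hi
      obtain ⟨m, rfl⟩ := Nat.exists_eq_add_of_le hji
      have := hab m
      simp only [show j + m + 1 - j = m + 1 by omega, show j + m - j = m by omega,
        show j + m + 1 - (j + 1) = m by omega]
      grind
    · intro i j hj hji hi
      obtain ⟨m, rfl⟩ := Nat.exists_eq_add_of_le hji
      have := hab m
      have := hab (m + 1)
      simp only [show j + 1 + m - j = m + 1 by omega, show j + 1 + m - (j + 1) = m by omega]
      grind
    · intro j hj hjn
      have := hab (n - j)
      grind
    · intro i j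
      simp only [twoColumns]
      grind

theorem IsGOGAm.le {n : ℕ} {Z : ℕ → ℕ → ℕ} (hZ : IsGOGAm n Z) {m t : ℕ}
    (ht : 1 ≤ t) (htm : t + (m + 1) ≤ n) :
    Z n (n - m) + Z (t + (m + 1)) t + (m + 1) ≤ n + Z (t + m) t := by
  have h := hZ.2.2 (n - (m + 1)) (by omega) (by omega)
    (fun i => if i ≤ m then n - i else t) (by simp)
    (fun i hi => by split_ifs <;> omega) (by split_ifs <;> omega)
  rw [show n - (n - (m + 1)) = m + 1 by omega, Finset.sum_range_succ] at h
  have hs : (0 : ℤ) ≤ ∑ i ∈ Finset.range m,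
      ((Z ((if i ≤ m then n - i else t) + i) (if i ≤ m then n - i else t) : ℤ) -
        (Z ((if i + 1 ≤ m then n - (i + 1) else t) + i)
          (if i + 1 ≤ m then n - (i + 1) else t) : ℤ)) := by
    refine Finset.sum_nonneg fun i hi => ?_
    have hi := Finset.mem_range.mp hi
    rw [if_pos (by omega), if_pos (by omega)]
    have := hZ.1.diagonal_mono_s19 (i := n - (i + 1)) (j := n - i) i (by omega) (by omega) (by omega)
    omega
  simp only [le_refl, if_true, show ¬ m + 1 ≤ m by omega, if_false,
    Nat.sub_add_cancel (show m ≤ n by omega)] at h hs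
  omega

theorem gogamRectSet_eq_image {n l k : ℕ} (hl : 1 ≤ l) (hln : l + 1 ≤ n) (hk : l ≤ k + 1) :
    GOGAmRectSet n 2 l =
      (fun p : (ℕ → ℕ) × (ℕ → ℕ) => twoColumns l p.1 p.2) '' hybridSet n l k := by
  ext X
  constructor
  · rintro ⟨Z, hZ, hX⟩
    set a : ℕ → ℕ := fun m => if m < l then Z (m + 1) 1 else 1 with ha
    have hb : ∀ m, m < l → 1 ≤ a m ∧ a (m + 1) ≤ a m ∧ a m ≤ Z (m + 2) 2 ∧
        Z (m + 2) 2 + flat a m + m ≤ n ∧ (m + 1 < l → Z (m + 1 + 2) 2 ≤ Z (m + 2) 2) := by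
      intro m hm
      have e1 := hZ.1.1 (m + 1) 1 le_rfl (by omega) (by omega)
      have e2 := hZ.1.2 (m + 1) 1 le_rfl (by omega) (by omega)
      have e4 := hZ.1.1 (m + 2) 1 le_rfl (by omega) (by omega)
      have e5 : Z (m + 2) 2 + m ≤ n := by
        cases m with
        | zero =>
          have := hZ.1.diagonal_mono_s19 (i := 2) (j := n) 0 (by omega) (by omega) (by omega)
          exact this.trans hZ.2.1
        | succ m =>
          have := hZ.le (m := m) (t := 2) (by omega) (by omega)
          have := hZ.1.diagonal_mono_s19 (i := 2) (j := n - m) m (by omega) (by omega) (by omega)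
          rw [Nat.sub_add_cancel (by omega)] at this
          rw [add_comm _ 2]
          omega
      have e6 : m + 1 < l → Z (m + 1 + 2) 2 ≤ Z (m + 2) 2 := fun h =>
        (hZ.1.2 (m + 2) 2 (by omega) (by omega) (by omega)).1
      have e7 := hZ.le (m := m) (t := 1) (by omega) (by omega)
      have e8 := hZ.1.diagonal_mono_s19 (i := 2) (j := n - m) m (by omega) (by omega) (by omega)
      rw [Nat.sub_add_cancel (by omega)] at e8
      rw [add_comm 1, add_comm 1] at e7
      rw [add_comm 2] at e8
      refine ⟨by grind, by grind, by grind, ?_, e6⟩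
      simp only [flat, ha]
      grind
    refine ⟨(a, fun m => if m < l then Z (m + 2) 2 else 0), ⟨?_, ?_, ?_⟩, ?_⟩
    · intro m hm
      simp [ha, hm]
    · intro m hm
      have := hb m hm
      simp only [hm, if_true]
      omega
    · intro m hm
      have := hb m (by omega)
      simp only [hm, show m < l by omega, if_true]
      omega
    · exact eq_twoColumns hln hX (fun m hm => by simp [ha, hm]) fun m hm => by simp [hm]
  · rintro ⟨⟨a, b⟩, ⟨h0, h1, h2⟩, rfl⟩
    simp only [] at h0 h1 h2
    have hb : ∀ m, m + 1 < l → b (m + 1) ≤ b m := fun m hm => (h2 m hm).1 (by omega)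
    set Z : ℕ → ℕ → ℕ := fun i j =>
      if i < j + l then (if j = 1 then a (i - j) else b (i - j)) else 1 with hZ
    have hZ1 : ∀ m, Z (1 + m) 1 = a m := by
      intro m
      have := h0 m
      simp only [hZ, Nat.add_sub_cancel_left]
      grind
    have hZ2 : ∀ m j, 2 ≤ j → Z (j + m) j = if m < l then b m else 1 := by
      intro m j hj
      simp only [hZ, Nat.add_sub_cancel_left]
      grind
    refine ⟨Z, ⟨⟨?_, ?_⟩, ?_, ?_⟩, ?_⟩
    · intro i j hj hji hi
      have := h1 (i - j)
      grind
    · intro i j hj hji hi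
      obtain ⟨m, rfl⟩ := Nat.exists_eq_add_of_le hji
      have := h1 m
      have := h0 m
      have := hb m
      rw [show j + m + 1 = (j + 1) + m by omega, hZ2 m (j + 1) (by omega),
        show j + 1 + m = j + (m + 1) by omega]
      obtain rfl | hj := eq_or_lt_of_le hj
      · rw [hZ1, hZ1]
        grind
      · rw [hZ2 _ _ hj, hZ2 _ _ hj]
        grind
    · have := hZ2 0 n (by omega)
      have := h1 0 (by omega)
      grind
    · intro k' hk1 hkn j hj0 hj hjpos
      obtain ⟨M, hM⟩ : ∃ M, n - k' = M + 1 := ⟨n - k' - 1, by omega⟩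
      rw [hM] at hj hjpos ⊢
      have hlow : ∀ d i, i + d = M + 1 → d + 1 ≤ j i := by
        intro d
        induction d with
        | zero => rintro i rfl; exact hjpos
        | succ d ih =>
          intro i hi
          have := ih (i + 1) (by omega)
          have := hj i (by omega)
          omega
      have hup : j M + M ≤ n := by
        have : ∀ i, i ≤ M → j i + i ≤ n := by
          intro i
          induction i with
          | zero => intro _; omega
          | succ i ih =>
            intro hi
            have := ih (by omega)
            have := hj i (by omega)
            omega
        exact this M le_rfl
      rw [Finset.sum_range_succ, Finset.sum_eq_zero, zero_add]
      · have hjM := hlow 1 M rfl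
        have hlt := hj M (by omega)
        rw [hZ2 M (j M) hjM]
        have := h1 M
        have := h1 (M + 1)
        have := h0 M
        have := h0 (M + 1)
        have := hb M
        obtain h | h := eq_or_lt_of_le hjpos
        · rw [← h, hZ1, hZ1]
          grind [flat]
        · rw [hZ2 _ _ h, hZ2 _ _ h]
          grind
      · intro i hi
        have hi := Finset.mem_range.mp hi
        rw [hZ2 _ _ ((show 2 ≤ M + 1 - i + 1 by omega).trans (hlow (M + 1 - i) i (by omega))),
          hZ2 _ _ ((show 2 ≤ M - i + 1 by omega).trans (hlow (M - i) (i + 1) (by omega))),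
          sub_self]
    · intro i j
      simp only [twoColumns, hZ]
      grind

/-- For every `n` and every `l` with `2 + l ≤ n + 1`, the `(n,2,l)` Gog and GOGAm
rectangles are equienumerated. -/
theorem gog_gogam_rectangles_width2_equienumerated (n l : ℕ) (hl : 1 ≤ l)
    (hln : 2 + l ≤ n + 1) :
    (GogRectSet n 2 l).ncard = (GOGAmRectSet n 2 l).ncard := by
  rw [gogRectSet_eq_image (by omega),
    gogamRectSet_eq_image (k := l - 1) hl (by omega) (by omega),
    (injOn_gog 0).ncard_image, (injOn_gogam (l - 1)).ncard_image]
  exact ncard_hybridSet (by omega)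
end
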